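/- With notation as in the construction of irreducible representations of W_{n,r}: for Bm ∈ Q_{n,r} and ρ = ρ_1 ⊠ ... ⊠ ρ_r an irreducible representation of S_Bm, the induced representation Ind_{wtS_Bm}^{W_{n,r}} (wtρ_1 ⊠ ... ⊠ wtρ_r) is irreducible, and its dimension equals [S_n : S_Bm] · Π_i dim ρ_i. -/

import Mathlib

/-- The permutation action of `S_m` on `(ℤ/rℤ)^m` (written multiplicatively). -/
def permAct (m r : ℕ) :
    Equiv.Perm (Fin m) →* MulAut (Fin m → Multiplicative (ZMod r)) where
  toFun σ := MulEquiv.arrowCongr σ (MulEquiv.refl _)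
  map_one' := by ext f i; rfl
  map_mul' := by intro σ τ; ext f i; rfl

/-- The wreath product `S_m ⋉ (ℤ/rℤ)^m`. -/
def WreathProduct (m r : ℕ) : Type :=
  SemidirectProduct (Fin m → Multiplicative (ZMod r)) (Equiv.Perm (Fin m)) (permAct m r)

noncomputable instance (m r : ℕ) : Group (WreathProduct m r) :=
  inferInstanceAs (Group (SemidirectProduct _ _ _))

/-- Irreducibility of a representation: the only invariant subspaces are `⊥` and `⊤`. -/
def IsIrred {k G V : Type*} [Field k] [Monoid G] [AddCommGroup V] [Module k V]
    (ρ : Representation k G V) : Prop :=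
  ∀ p : Submodule k V, (∀ g : G, ∀ v ∈ p, ρ g v ∈ p) → p = ⊥ ∨ p = ⊤

open scoped TensorProduct

theorem burnside_span {G V : Type*} [Group G] [AddCommGroup V] [Module ℂ V]
    [FiniteDimensional ℂ V] [Nontrivial V] (ρ : Representation ℂ G V) (h : IsIrred ρ)
    (f : Module.End ℂ V) : f ∈ Submodule.span ℂ (Set.range ρ) := by
  classical
  let A : Subalgebra ℂ (Module.End ℂ V) := Algebra.adjoin ℂ (Set.range ρ)
  have hA : ∀ g, ρ g ∈ A := fun g => Algebra.subset_adjoin ⟨g, rfl⟩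
  have hsimple : IsSimpleModule A V := by
    rw [isSimpleModule_iff]
    refine { exists_pair_ne := ⟨⊥, ⊤, bot_ne_top⟩, eq_bot_or_eq_top := ?_ }
    intro p
    rcases h (p.restrictScalars ℂ) (fun g v hv => p.smul_mem (⟨ρ g, hA g⟩ : A) hv) with h1 | h1
    · left
      exact (Submodule.restrictScalars_eq_bot_iff ℂ A V).1 h1
    · right
      exact (Submodule.restrictScalars_eq_top_iff ℂ A V).1 h1
  have hend := IsSimpleModule.algebraMap_end_bijective_of_isAlgClosed (A := A) (V := V) ℂ
  let F : Module.End (Module.End A V) V :=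
    { toFun := f
      map_add' := f.map_add
      map_smul' := by
        intro c v
        obtain ⟨z, rfl⟩ := hend.2 c
        simp }
  obtain ⟨s, hs⟩ := (inferInstance : Module.Finite ℂ V).fg_top
  obtain ⟨r, hr⟩ := jacobson_density F s
  have hfr : f = r.1 := by
    refine LinearMap.ext_on hs ?_
    intro v hv
    exact hr v hv
  have hmem : f ∈ Subalgebra.toSubmodule A := by rw [hfr]; exact r.2
  rw [Algebra.adjoin_eq_span] at hmem
  have : Submonoid.closure (Set.range ρ) = MonoidHom.mrange ρ := by
    rw [← MonoidHom.coe_mrange, Submonoid.closure_eq]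
  rw [this] at hmem
  simpa using hmem

theorem multilinear_span {ι : Type*} [Fintype ι] {M : ι → Type*} {N : Type*}
    [∀ i, AddCommGroup (M i)] [∀ i, Module ℂ (M i)] [AddCommGroup N] [Module ℂ N]
    (φ : MultilinearMap ℂ M N) (B : ∀ i, Set (M i)) (S : Submodule ℂ N)
    (hB : ∀ f : ∀ i, M i, (∀ i, f i ∈ B i) → φ f ∈ S)
    (hspan : ∀ i, ∀ x, x ∈ Submodule.span ℂ (B i)) (f : ∀ i, M i) : φ f ∈ S := by
  classical
  have key : ∀ s : Finset ι, ∀ f : ∀ i, M i, (∀ i, i ∉ s → f i ∈ B i) → φ f ∈ S := by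
    intro s
    induction s using Finset.induction_on with
    | empty => intro f hf; exact hB f (fun i => hf i (by simp))
    | insert a s ha ih =>
      intro f hf
      have : ∀ x, x ∈ Submodule.span ℂ (B a) → φ (Function.update f a x) ∈ S := by
        intro x hx
        induction hx using Submodule.span_induction with
        | mem x hx =>
          apply ih
          intro i hi
          by_cases hia : i = a
          · subst hia; simpa using hx
          · rw [Function.update_of_ne hia]
            exact hf i (by simp [hia, hi])
        | zero => simp
        | add x y _ _ h1 h2 => rw [φ.map_update_add]; exact S.add_mem h1 h2
        | smul c x _ h1 => rw [φ.map_update_smul]; exact S.smul_mem _ h1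
      simpa using this (f a) (hspan a _)
  exact key Finset.univ f (by simp)

theorem tensor_irred {r : ℕ} {V : Fin r → Type*} [∀ a, AddCommGroup (V a)] [∀ a, Module ℂ (V a)]
    [∀ a, FiniteDimensional ℂ (V a)] [∀ a, Nontrivial (V a)] {G : Fin r → Type*}
    [∀ a, Group (G a)] (ρ : ∀ a, Representation ℂ (G a) (V a)) (hρ : ∀ a, IsIrred (ρ a))
    (p : Submodule ℂ (PiTensorProduct ℂ V))
    (hp : ∀ g : ∀ a, G a, ∀ v ∈ p, PiTensorProduct.map (fun a => ρ a (g a)) v ∈ p) :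
    p = ⊥ ∨ p = ⊤ := by
  classical
  have hall : ∀ f : ∀ a, V a →ₗ[ℂ] V a, ∀ v ∈ p, PiTensorProduct.map f v ∈ p := by
    intro f v hv
    have := multilinear_span (PiTensorProduct.mapMultilinear ℂ V V)
      (fun a => Set.range (ρ a)) (p.comap (LinearMap.applyₗ v)) (by
        intro f hf
        choose g hg using hf
        have : f = fun a => ρ a (g a) := by funext a; exact (hg a).symm
        subst this
        exact hp g v hv) (fun a x => burnside_span (ρ a) (hρ a) x) f
    exact this
  by_cases hbot : p = ⊥
  · exact Or.inl hbot
  right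
  obtain ⟨v, hv, hv0⟩ := p.exists_mem_ne_zero_of_ne_bot hbot
  let b := fun a => Module.finBasis ℂ (V a)
  let B := Basis.piTensorProduct b
  obtain ⟨q, hq⟩ : ∃ q, B.repr v q ≠ 0 := by
    by_contra hcon
    push Not at hcon
    exact hv0 (B.repr.map_eq_zero_iff.1 (Finsupp.ext hcon))
  have htp : ∀ w : ∀ a, V a, PiTensorProduct.tprod ℂ w ∈ p := by
    intro w
    have h1 := hall (fun a => ((b a).coord (q a)).smulRight (w a)) v hv
    have h2 : PiTensorProduct.map (fun a => ((b a).coord (q a)).smulRight (w a))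
        = (B.coord q).smulRight (PiTensorProduct.tprod ℂ w) := by
      apply PiTensorProduct.ext
      ext x
      simp only [LinearMap.compMultilinearMap_apply, PiTensorProduct.map_tprod,
        LinearMap.smulRight_apply, Module.Basis.coord_apply, B]
      rw [Basis.piTensorProduct_repr_tprod_apply, MultilinearMap.map_smul_univ]
    rw [h2] at h1
    have := p.smul_mem (B.repr v q)⁻¹ h1
    simpa [smul_smul, hq] using this
  rw [eq_top_iff, ← PiTensorProduct.span_tprod_eq_top, Submodule.span_le]
  rintro _ ⟨w, rfl⟩
  exact htp w

theorem wreath_card (m r : ℕ) : Nat.card (WreathProduct m r) = r ^ m * m.factorial := by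
  have e : WreathProduct m r ≃ (Fin m → Multiplicative (ZMod r)) × Equiv.Perm (Fin m) :=
    SemidirectProduct.equivProd
  rw [Nat.card_congr e, Nat.card_prod, Nat.card_pi]
  have h : Nat.card (Multiplicative (ZMod r)) = r := by
    rw [Nat.card_congr Multiplicative.toAdd, Nat.card_zmod]
  simp [h, Fintype.card_perm]

theorem embed_injective {n r : ℕ} {m : Fin r → ℕ} (E : (Σ a : Fin r, Fin (m a)) ≃ Fin n)
    (e : (∀ a : Fin r, WreathProduct (m a) r) →* WreathProduct n r)
    (he : ∀ g : ∀ a : Fin r, WreathProduct (m a) r,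
      e g = ⟨fun x => (g (E.symm x).1).left (E.symm x).2,
             E.permCongr (Equiv.sigmaCongrRight fun a => (g a).right)⟩) :
    Function.Injective e := by
  intro g h hgh
  rw [he, he] at hgh
  have h1 := congrArg SemidirectProduct.left hgh
  have h2 := congrArg SemidirectProduct.right hgh
  simp only at h1 h2
  funext a
  apply SemidirectProduct.ext
  · funext j
    have h3 := congrFun h1 (E ⟨a, j⟩)
    have key : ∀ z : (Σ a : Fin r, Fin (m a)), z = ⟨a, j⟩ →
        (g z.1).left z.2 = (h z.1).left z.2 → (g a).left j = (h a).left j := by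
      rintro _ rfl h4
      exact h4
    exact key _ (E.symm_apply_apply _) h3
  · ext j
    have := congrArg (fun s => E.symm (s (E ⟨a, j⟩))) h2
    simp [Equiv.permCongr_apply] at this
    exact congrArg Fin.val this

theorem coset_card {n r : ℕ} {m : Fin r → ℕ} (hm : ∑ a : Fin r, m a = n)
    (e : (∀ a : Fin r, WreathProduct (m a) r) →* WreathProduct n r)
    (hinj : Function.Injective e) (T : Finset (WreathProduct n r))
    (hT : ∀ g : WreathProduct n r, ∃! t, t ∈ T ∧ ∃ h, g = t * e h) :
    T.card = Nat.factorial n / ∏ a : Fin r, Nat.factorial (m a) := by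
  let F : T × (∀ a : Fin r, WreathProduct (m a) r) → WreathProduct n r := fun x => x.1.1 * e x.2
  have hF : Function.Bijective F := by
    constructor
    · rintro ⟨t, h⟩ ⟨t', h'⟩ hh
      have htt : t.1 = t'.1 :=
        (hT (F ⟨t, h⟩)).unique ⟨t.2, h, rfl⟩ ⟨t'.2, h', hh⟩
      have htt' : t = t' := Subtype.ext htt
      subst htt'
      have := hinj (mul_left_cancel (show t.1 * e h = t.1 * e h' from hh))
      rw [this]
    · intro g
      obtain ⟨t, ⟨ht, h, hg⟩, _⟩ := hT g
      exact ⟨⟨⟨t, ht⟩, h⟩, hg.symm⟩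
  have hc := Nat.card_congr (Equiv.ofBijective F hF)
  rw [Nat.card_prod, Nat.card_pi, wreath_card] at hc
  simp only [wreath_card, Finset.prod_mul_distrib, Finset.prod_pow_eq_pow_sum, hm,
    Nat.card_eq_fintype_card, Fintype.card_coe] at hc
  have hr : 0 < r ^ n := by
    rcases Nat.eq_zero_or_pos r with h | h
    · subst h
      simp at hm
      simp [← hm]
    · positivity
  have hP : 0 < ∏ a : Fin r, Nat.factorial (m a) := Finset.prod_pos fun a _ => Nat.factorial_pos _
  symm
  apply Nat.div_eq_of_eq_mul_left hP
  apply Nat.eq_of_mul_eq_mul_left hr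
  rw [← hc]; ring

theorem induced_finrank {G U W : Type*} [Group G] [AddCommGroup U] [Module ℂ U]
    [FiniteDimensional ℂ U] [AddCommGroup W] [Module ℂ W] (σW : Representation ℂ G W)
    (ι : U →ₗ[ℂ] W) (hι : Function.Injective ι) (T : Finset G)
    (hind : iSupIndep (fun t : T => Submodule.map (σW t.1) (LinearMap.range ι)))
    (hspan : (⨆ t : T, Submodule.map (σW t.1) (LinearMap.range ι)) = ⊤) :
    Module.finrank ℂ W = T.card * Module.finrank ℂ U := by
  classical
  have hinternal := DirectSum.isInternal_submodule_of_iSupIndep_of_iSup_eq_top hind hspan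
  rw [← (LinearEquiv.ofBijective (DirectSum.coeLinearMap _) hinternal).finrank_eq,
    Module.finrank_directSum]
  have hinj : ∀ g, Function.Injective (σW g) := by
    intro g x y hxy
    have := congrArg (σW g⁻¹) hxy
    simpa using this
  have : ∀ t : T, Module.finrank ℂ (Submodule.map (σW t.1) (LinearMap.range ι))
      = Module.finrank ℂ U := by
    intro t
    rw [← (Submodule.equivMapOfInjective (σW t.1) (hinj _) (LinearMap.range ι)).finrank_eq,
      LinearMap.finrank_range_of_inj hι]
  simp [this]

theorem finrank_tensor {r : ℕ} (V : Fin r → Type*) [∀ a, AddCommGroup (V a)]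
    [∀ a, Module ℂ (V a)] [∀ a, FiniteDimensional ℂ (V a)] :
    FiniteDimensional ℂ (PiTensorProduct ℂ V) ∧
    Module.finrank ℂ (PiTensorProduct ℂ V) = ∏ a, Module.finrank ℂ (V a) := by
  let B := Basis.piTensorProduct (fun a => Module.finBasis ℂ (V a))
  refine ⟨Module.Basis.finiteDimensional_of_finite B, ?_⟩
  rw [Module.finrank_eq_card_basis B]
  simp

/-- The character of `(ℤ/rℤ)^n` attached to a labelling `c`. -/
noncomputable def chiHom {n r : ℕ} [NeZero r] (ζ : ℂ) (hζ : ζ ^ r = 1) (c : Fin n → ℕ) :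
    (Fin n → Multiplicative (ZMod r)) →* ℂ where
  toFun x := ∏ y, ζ ^ (c y * (Multiplicative.toAdd (x y)).val)
  map_one' := by simp
  map_mul' := by
    intro x x'
    rw [← Finset.prod_mul_distrib]
    refine Finset.prod_congr rfl fun y _ => ?_
    have h1 : (ζ ^ c y) ^ r = 1 := by rw [← pow_mul, mul_comm, pow_mul, hζ, one_pow]
    rw [Pi.mul_apply, toAdd_mul, ZMod.val_add, pow_mul, pow_mul, pow_mul, ← pow_add]
    exact (pow_eq_pow_mod _ h1).symm

theorem chiHom_apply {n r : ℕ} [NeZero r] (ζ : ℂ) (hζ : ζ ^ r = 1) (c : Fin n → ℕ)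
    (x : Fin n → Multiplicative (ZMod r)) :
    chiHom ζ hζ c x = ∏ y, ζ ^ (c y * (Multiplicative.toAdd (x y)).val) := rfl

theorem chiHom_inj {n r : ℕ} [NeZero r] (ζ : ℂ) (hζ : IsPrimitiveRoot ζ r) (c d : Fin n → ℕ)
    (hc : ∀ y, c y < r) (hd : ∀ y, d y < r)
    (h : chiHom ζ hζ.pow_eq_one c = chiHom ζ hζ.pow_eq_one d) : c = d := by
  classical
  funext y
  by_cases hr : r = 1
  · have := hc y
    have := hd y
    omega
  have : Fact (1 < r) := ⟨by have := NeZero.pos r; omega⟩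
  have hev : ∀ b : Fin n → ℕ, chiHom ζ hζ.pow_eq_one b
      (Pi.mulSingle y (Multiplicative.ofAdd (1 : ZMod r))) = ζ ^ b y := by
    intro b
    rw [chiHom_apply, Finset.prod_eq_single y]
    · simp [ZMod.val_one]
    · intro y' _ hy
      simp [Pi.mulSingle_eq_of_ne hy]
    · simp
  have h1 := hev c
  rw [h, hev d] at h1
  exact hζ.pow_inj (hc y) (hd y) h1.symm

theorem chi_sum {n r : ℕ} [NeZero r] (ζ : ℂ) (hζ : IsPrimitiveRoot ζ r) (c d : Fin n → ℕ)
    (hc : ∀ y, c y < r) (hd : ∀ y, d y < r) (hcd : c ≠ d) :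
    ∑ x, chiHom (n := n) ζ hζ.pow_eq_one c x⁻¹ * chiHom ζ hζ.pow_eq_one d x = 0 := by
  have := sum_hom_units_eq_zero
    ((chiHom ζ hζ.pow_eq_one c).comp (invMonoidHom) * chiHom ζ hζ.pow_eq_one d) (by
      intro h
      apply hcd
      apply chiHom_inj ζ hζ c d hc hd
      refine MonoidHom.ext fun x => ?_
      have h1 := DFunLike.congr_fun h x
      have h1' : chiHom ζ hζ.pow_eq_one c x⁻¹ * chiHom ζ hζ.pow_eq_one d x = 1 := h1
      have h2 : chiHom ζ hζ.pow_eq_one c x * chiHom ζ hζ.pow_eq_one c x⁻¹ = 1 := by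
        rw [← map_mul, mul_inv_cancel, map_one]
      calc chiHom ζ hζ.pow_eq_one c x
          = chiHom ζ hζ.pow_eq_one c x *
            (chiHom ζ hζ.pow_eq_one c x⁻¹ * chiHom ζ hζ.pow_eq_one d x) := by rw [h1', mul_one]
        _ = chiHom ζ hζ.pow_eq_one d x := by rw [← mul_assoc, h2, one_mul])
  exact this

/-- Constructor for elements of the wreath product. -/
def wmk {n r : ℕ} (x : Fin n → Multiplicative (ZMod r)) (s : Equiv.Perm (Fin n)) :
    WreathProduct n r := ⟨x, s⟩

theorem mem_range_of_label {n r : ℕ} {m : Fin r → ℕ} (E : (Σ a : Fin r, Fin (m a)) ≃ Fin n)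
    (e : (∀ a : Fin r, WreathProduct (m a) r) →* WreathProduct n r)
    (he : ∀ g : ∀ a : Fin r, WreathProduct (m a) r,
      e g = ⟨fun x => (g (E.symm x).1).left (E.symm x).2,
             E.permCongr (Equiv.sigmaCongrRight fun a => (g a).right)⟩)
    (g : WreathProduct n r)
    (hg : ∀ y, (E.symm (g.right.symm y)).1 = (E.symm y).1) : ∃ h, g = e h := by
  have hg' : ∀ y, (E.symm (g.right y)).1 = (E.symm y).1 := by
    intro y
    rw [← hg (g.right y), Equiv.symm_apply_apply]
  have key : ∀ (f : Fin n → Fin n), (∀ y, (E.symm (f y)).1 = (E.symm y).1) →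
      ∀ a (j : Fin (m a)), ∃ j', f (E ⟨a, j⟩) = E ⟨a, j'⟩ := by
    intro f hf a j
    have := hf (E ⟨a, j⟩)
    rw [Equiv.symm_apply_apply] at this
    generalize hz : E.symm (f (E ⟨a, j⟩)) = z at this
    obtain ⟨b, k⟩ := z
    simp only at this
    subst this
    exact ⟨k, by rw [← hz, Equiv.apply_symm_apply]⟩
  choose f hf using key g.right hg'
  choose f' hf' using key g.right.symm hg
  have hinj : ∀ a, ∀ j k : Fin (m a), E ⟨a, j⟩ = E ⟨a, k⟩ → j = k := by
    intro a j k h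
    have := E.injective h
    simpa using this
  have hl : ∀ a, Function.LeftInverse (f' a) (f a) := ?_
  have hr : ∀ a, Function.RightInverse (f' a) (f a) := ?_
  · refine ⟨fun a => wmk (fun j => g.left (E ⟨a, j⟩)) ⟨f a, f' a, hl a, hr a⟩, ?_⟩
    refine Eq.trans ?_ (he _).symm
    apply SemidirectProduct.ext
    · funext x
      show g.left x = g.left (E (E.symm x))
      rw [Equiv.apply_symm_apply]
    · apply Equiv.ext
      intro x
      obtain ⟨⟨a, j⟩, rfl⟩ := E.surjective x
      simp only [Equiv.permCongr_apply, Equiv.symm_apply_apply]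
      exact hf a j
  · intro a j
    apply hinj
    rw [← hf, ← hf', Equiv.apply_symm_apply]
  · intro a j
    apply hinj
    rw [← hf', ← hf, Equiv.symm_apply_apply]

theorem wreath_comm {n r : ℕ} (g : WreathProduct n r) (x : Fin n → Multiplicative (ZMod r)) :
    wmk x 1 * g = g * wmk (fun y => x (g.right y)) 1 := by
  apply SemidirectProduct.ext
  · show x * g.left = g.left * _
    rw [mul_comm]
    congr 1
    funext y
    show _ = x (g.right (g.right.symm y))
    simp
  · show 1 * g.right = g.right * 1
    simp

/-- The averaging operator projecting onto the isotypic part of the character of `c`. -/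
noncomputable def avgOp {n r : ℕ} [NeZero r] {W : Type*} [AddCommGroup W] [Module ℂ W]
    (ζ : ℂ) (hζ : ζ ^ r = 1) (c : Fin n → ℕ)
    (σW : Representation ℂ (WreathProduct n r) W) : W →ₗ[ℂ] W :=
  ∑ x : Fin n → Multiplicative (ZMod r), chiHom ζ hζ c x⁻¹ • σW (wmk x 1)

theorem avgOp_eigen {n r : ℕ} [NeZero r] {W : Type*} [AddCommGroup W] [Module ℂ W]
    (ζ : ℂ) (hζ : ζ ^ r = 1) (c d : Fin n → ℕ)
    (σW : Representation ℂ (WreathProduct n r) W) (w : W)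
    (hw : ∀ x, σW (wmk x 1) w = chiHom ζ hζ d x • w) :
    avgOp ζ hζ c σW w = (∑ x, chiHom ζ hζ c x⁻¹ * chiHom ζ hζ d x) • w := by
  simp [avgOp, LinearMap.sum_apply, hw, smul_smul, Finset.sum_smul]

theorem translate_eigen {n r : ℕ} [NeZero r] {W : Type*} [AddCommGroup W] [Module ℂ W]
    (ζ : ℂ) (hζ : ζ ^ r = 1) (c : Fin n → ℕ)
    (σW : Representation ℂ (WreathProduct n r) W) (w : W)
    (hw : ∀ x, σW (wmk x 1) w = chiHom ζ hζ c x • w) (g : WreathProduct n r)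
    (x : Fin n → Multiplicative (ZMod r)) :
    σW (wmk x 1) (σW g w) = chiHom ζ hζ (fun y => c (g.right.symm y)) x • σW g w := by
  rw [← Module.End.mul_apply, ← map_mul, wreath_comm, map_mul, Module.End.mul_apply, hw, map_smul]
  congr 1
  rw [chiHom_apply, chiHom_apply,
    ← Equiv.prod_comp g.right (fun y => ζ ^ (c (g.right.symm y) * (Multiplicative.toAdd (x y)).val))]
  refine Finset.prod_congr rfl fun y _ => ?_
  rw [Equiv.symm_apply_apply]

theorem induced_irred {n r : ℕ} [NeZero r] {m : Fin r → ℕ} (ζ : ℂ) (hζ : IsPrimitiveRoot ζ r)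
    (E : (Σ a : Fin r, Fin (m a)) ≃ Fin n)
    (e : (∀ a : Fin r, WreathProduct (m a) r) →* WreathProduct n r)
    (he : ∀ g : ∀ a : Fin r, WreathProduct (m a) r,
      e g = ⟨fun x => (g (E.symm x).1).left (E.symm x).2,
             E.permCongr (Equiv.sigmaCongrRight fun a => (g a).right)⟩)
    {U W : Type*} [AddCommGroup U] [Module ℂ U] [AddCommGroup W] [Module ℂ W]
    (σW : Representation ℂ (WreathProduct n r) W) (ι : U →ₗ[ℂ] W)
    (hU : ∀ p : Submodule ℂ U, (∀ h, ∀ u ∈ p, ∀ u', σW (e h) (ι u) = ι u' → u' ∈ p) →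
      p = ⊥ ∨ p = ⊤)
    (hchar : ∀ x u, σW (wmk x 1) (ι u) =
      chiHom ζ hζ.pow_eq_one (fun y => ((E.symm y).1 : ℕ)) x • ι u)
    (hι : Function.Injective ι)
    (T : Finset (WreathProduct n r))
    (hT : ∀ g : WreathProduct n r, ∃! t, t ∈ T ∧ ∃ h, g = t * e h)
    (hspan : (⨆ t : T, Submodule.map (σW t.1) (LinearMap.range ι)) = ⊤) :
    IsIrred σW := by
  classical
  intro p hp
  by_cases hbot : p = ⊥
  · exact Or.inl hbot
  right
  set c : Fin n → ℕ := fun y => ((E.symm y).1 : ℕ) with hc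
  have hclt : ∀ y, c y < r := fun y => (E.symm y).1.2
  have havg0 : ∀ g : WreathProduct n r, (¬ ∃ h, g = e h) → ∀ u,
      avgOp ζ hζ.pow_eq_one c σW (σW g (ι u)) = 0 := by
    intro g hg u
    rw [avgOp_eigen ζ hζ.pow_eq_one c _ σW _
      (translate_eigen ζ hζ.pow_eq_one c σW (ι u) (fun x => hchar x u) g),
      chi_sum ζ hζ c _ hclt (fun y => hclt _), zero_smul]
    intro hcc
    apply hg
    apply mem_range_of_label E e he g
    intro y
    exact Fin.ext (congrFun hcc y).symm
  have havg1 : ∀ u, avgOp ζ hζ.pow_eq_one c σW (ι u) =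
      (Fintype.card (Fin n → Multiplicative (ZMod r)) : ℂ) • ι u := by
    intro u
    rw [avgOp_eigen ζ hζ.pow_eq_one c c σW _ (fun x => hchar x u)]
    congr 1
    have : ∀ x : Fin n → Multiplicative (ZMod r),
        chiHom ζ hζ.pow_eq_one c x⁻¹ * chiHom ζ hζ.pow_eq_one c x = 1 := by
      intro x
      rw [← map_mul, inv_mul_cancel, map_one]
    simp only [this, Finset.sum_const, Finset.card_univ, nsmul_eq_mul, mul_one]
  have havgp : ∀ w ∈ p, avgOp ζ hζ.pow_eq_one c σW w ∈ p := by
    intro w hw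
    rw [avgOp, LinearMap.sum_apply]
    exact p.sum_mem fun x _ => p.smul_mem _ (hp _ _ hw)
  obtain ⟨w, hw, hw0⟩ := p.exists_mem_ne_zero_of_ne_bot hbot
  have hwtop : w ∈ ⨆ t : T, Submodule.map (σW t.1) (LinearMap.range ι) := by
    rw [hspan]; trivial
  obtain ⟨f, hf, hfw⟩ := (Submodule.mem_iSup_iff_exists_finsupp _ _).1 hwtop
  have hu : ∀ t : T, ∃ u, σW t.1 (ι u) = f t := by
    intro t
    obtain ⟨_, ⟨u, rfl⟩, h⟩ := hf t
    exact ⟨u, h⟩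
  choose u hu using hu
  have hwsum : w = ∑ t : T, σW t.1 (ι (u t)) := by
    rw [← hfw, Finsupp.sum_fintype _ _ (fun _ => rfl)]
    exact Finset.sum_congr rfl fun t _ => (hu t).symm
  obtain ⟨t, ht⟩ : ∃ t, u t ≠ 0 := by
    by_contra hcon
    push Not at hcon
    apply hw0
    rw [hwsum]
    simp [hcon]
  have hcalc : avgOp ζ hζ.pow_eq_one c σW (σW (t.1)⁻¹ w) =
      (Fintype.card (Fin n → Multiplicative (ZMod r)) : ℂ) • ι (u t) := by
    rw [hwsum, map_sum, map_sum, Finset.sum_eq_single t]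
    · rw [← havg1, ← Module.End.mul_apply (σW (t.1)⁻¹), ← map_mul, inv_mul_cancel, map_one,
        Module.End.one_apply]
    · intro t' _ htt
      rw [← Module.End.mul_apply (σW (t.1)⁻¹), ← map_mul]
      apply havg0
      rintro ⟨h, hh⟩
      apply htt
      apply Subtype.ext
      refine (hT t'.1).unique ⟨t'.2, 1, by simp⟩ ⟨t.2, h, ?_⟩
      rw [← hh, mul_inv_cancel_left]
    · simp
  have hmem : ι (u t) ∈ p := by
    have h1 := havgp _ (hp (t.1)⁻¹ w hw)
    rw [hcalc] at h1
    have h2 : (Fintype.card (Fin n → Multiplicative (ZMod r)) : ℂ) ≠ 0 :=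
      Nat.cast_ne_zero.2 Fintype.card_ne_zero
    exact (p.smul_mem_iff h2).1 h1
  have hcom : p.comap ι = ⊤ := by
    refine (hU (p.comap ι) ?_).resolve_left ?_
    · intro h v hv v' hvv
      show ι v' ∈ p
      rw [← hvv]
      exact hp _ _ hv
    · intro hb
      have : u t ∈ p.comap ι := hmem
      rw [hb] at this
      exact ht ((Submodule.mem_bot ℂ).1 this)
  rw [eq_top_iff, ← hspan]
  refine iSup_le fun t => ?_
  rintro _ ⟨_, ⟨v, rfl⟩, rfl⟩
  apply hp
  have : v ∈ p.comap ι := by rw [hcom]; trivial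
  exact this

/-- for `Bm ∈ Q_{n,r}` and `ρ = ρ_1 ⊠ ⋯ ⊠ ρ_r` an irreducible
representation of `S_Bm` (each `ρ_a` irreducible for `S_{m_a}`), the representation of
`W_{n,r} = S_n ⋉ (ℤ/rℤ)^n` induced from the extension `wtρ_1 ⊠ ⋯ ⊠ wtρ_r` of `ρ` to
`wtS_Bm = wtS_{m_1} × ⋯ × wtS_{m_r}` (where `(ℤ/rℤ)^{m_a}` acts through the character
`(1 ↦ ζ^{a-1})^{⊗ m_a}`) is irreducible, and its dimension is
`[S_n : S_Bm] · ∏_a dim ρ_a = (n! / ∏_a m_a!) · ∏_a dim ρ_a`.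

The induced representation is presented as a representation `σW` of `W_{n,r}` on `W`
containing `wtρ = ρt` (on the tensor product `⨂_a V_a`) equivariantly via `ι` along the
embedding `e : wtS_Bm →* W_{n,r}`, such that the translates of `ι(⨂ V_a)` by a system
`T` of coset representatives are independent and span `W`. -/
theorem induced_rep_irreducible_and_dim (n r : ℕ) (m : Fin r → ℕ)
    (hm : ∑ a : Fin r, m a = n) (ζ : ℂ) (hζ : IsPrimitiveRoot ζ r)
    (V : Fin r → Type*) [∀ a, AddCommGroup (V a)] [∀ a, Module ℂ (V a)]
    [∀ a, FiniteDimensional ℂ (V a)] [∀ a, Nontrivial (V a)]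
    (ρ : ∀ a : Fin r, Representation ℂ (Equiv.Perm (Fin (m a))) (V a))
    (hρ : ∀ a, IsIrred (ρ a))
    -- the identification of `Fin n` with `⨆ Fin (m a)` and the induced embedding
    -- `e : wtS_Bm →* W_{n,r}`
    (E : (Σ a : Fin r, Fin (m a)) ≃ Fin n)
    (e : (∀ a : Fin r, WreathProduct (m a) r) →* WreathProduct n r)
    (he : ∀ g : ∀ a : Fin r, WreathProduct (m a) r,
      e g = ⟨fun x => (g (E.symm x).1).left (E.symm x).2,
             E.permCongr (Equiv.sigmaCongrRight fun a => (g a).right)⟩)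
    -- the representation `wtρ_1 ⊠ ⋯ ⊠ wtρ_r` of `wtS_Bm` on `⨂_a V_a`
    (ρt : Representation ℂ (∀ a : Fin r, WreathProduct (m a) r) (PiTensorProduct ℂ V))
    (hρt : ∀ (g : ∀ a : Fin r, WreathProduct (m a) r) (v : ∀ a, V a),
      ρt g (PiTensorProduct.tprod ℂ v) =
        (∏ a : Fin r, ∏ j : Fin (m a),
          ζ ^ ((a : ℕ) * (Multiplicative.toAdd ((g a).left j)).val)) •
          PiTensorProduct.tprod ℂ (fun a => ρ a (g a).right (v a)))
    -- the induced representation `(W, σW)`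
    (W : Type*) [AddCommGroup W] [Module ℂ W]
    (σW : Representation ℂ (WreathProduct n r) W)
    (ι : PiTensorProduct ℂ V →ₗ[ℂ] W) (hι : Function.Injective ι)
    (heq : ∀ h, σW (e h) ∘ₗ ι = ι ∘ₗ (ρt h))
    (T : Finset (WreathProduct n r))
    (hT : ∀ g : WreathProduct n r, ∃! t, t ∈ T ∧ ∃ h, g = t * e h)
    (hind : iSupIndep (fun t : T => Submodule.map (σW t.1) (LinearMap.range ι)))
    (hspan : (⨆ t : T, Submodule.map (σW t.1) (LinearMap.range ι)) = ⊤) :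
    IsIrred σW ∧
    Module.finrank ℂ W =
      (Nat.factorial n / ∏ a : Fin r, Nat.factorial (m a)) *
        ∏ a : Fin r, Module.finrank ℂ (V a) := by
  classical
  have hdim : Module.finrank ℂ W =
      (Nat.factorial n / ∏ a : Fin r, Nat.factorial (m a)) *
        ∏ a : Fin r, Module.finrank ℂ (V a) := by
    have hfd := (finrank_tensor V).1
    rw [induced_finrank σW ι hι T hind hspan, (finrank_tensor V).2,
      coset_card hm e (embed_injective E e he) T hT]
  refine ⟨?_, hdim⟩
  rcases Nat.eq_zero_or_pos r with hr0 | hrpos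
  · subst hr0
    have hn : n = 0 := by simpa using hm.symm
    subst hn
    have h1 : Module.finrank ℂ W = 1 := by simpa using hdim
    intro p _
    have : IsSimpleModule ℂ W := isSimpleModule_iff_finrank_eq_one.2 h1
    exact eq_bot_or_eq_top p
  have : NeZero r := ⟨hrpos.ne'⟩
  have hρt' : ∀ g, ρt g = (∏ a : Fin r, ∏ j : Fin (m a),
          ζ ^ ((a : ℕ) * (Multiplicative.toAdd ((g a).left j)).val)) •
          PiTensorProduct.map (fun a => ρ a (g a).right) := by
    intro g
    apply PiTensorProduct.ext
    ext v
    simp only [LinearMap.compMultilinearMap_apply, LinearMap.smul_apply,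
      PiTensorProduct.map_tprod]
    exact hρt g v
  refine induced_irred ζ hζ E e he σW ι ?_ ?_ hι T hT hspan
  · intro p hp
    refine tensor_irred ρ hρ p ?_
    intro g v hv
    refine hp (fun a => wmk 1 (g a)) v hv _ ?_
    have h1 := LinearMap.congr_fun (heq (fun a => wmk 1 (g a))) v
    refine h1.trans ?_
    rw [LinearMap.comp_apply, hρt']
    congr 1
    have h2 : (∏ a : Fin r, ∏ j : Fin (m a),
          ζ ^ ((a : ℕ) * (Multiplicative.toAdd
            ((wmk (1 : Fin (m a) → Multiplicative (ZMod r)) (g a)).left j)).val)) = 1 := by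
      refine Finset.prod_eq_one fun a _ => Finset.prod_eq_one fun j _ => ?_
      show ζ ^ ((a : ℕ) * (0 : ZMod r).val) = 1
      simp
    rw [h2, one_smul]
    rfl
  · intro x u
    have hx : wmk x 1 = e (fun a => wmk (fun j => x (E ⟨a, j⟩)) 1) := by
      refine Eq.trans ?_ (he _).symm
      apply SemidirectProduct.ext
      · funext y
        show x y = x (E (E.symm y))
        rw [Equiv.apply_symm_apply]
      · apply Equiv.ext
        intro y
        show y = E (E.symm y)
        rw [Equiv.apply_symm_apply]
    rw [hx]
    have h1 := LinearMap.congr_fun (heq (fun a => wmk (fun j => x (E ⟨a, j⟩)) 1)) u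
    refine h1.trans ?_
    rw [LinearMap.comp_apply, hρt', LinearMap.smul_apply, map_smul]
    have h3 : PiTensorProduct.map
        (fun a => ρ a (wmk (fun j => x (E ⟨a, j⟩)) (1 : Equiv.Perm (Fin (m a)))).right)
        = LinearMap.id := by
      have : (fun a => ρ a (wmk (fun j => x (E ⟨a, j⟩)) (1 : Equiv.Perm (Fin (m a)))).right)
          = fun a => LinearMap.id := by
        funext a
        exact map_one (ρ a)
      rw [this, PiTensorProduct.map_id]
    rw [h3, LinearMap.id_apply]
    congr 1
    rw [chiHom_apply, ← Equiv.prod_comp E, Fintype.prod_sigma]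
    refine Finset.prod_congr rfl fun a _ => Finset.prod_congr rfl fun j _ => ?_
    rw [Equiv.symm_apply_apply]
    rfl
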